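/- arXiv:1912.10415 — 3 statements merged into one kernel-verified Lean document; each statement's English description precedes it below -/
import Mathlib

section
/- Let V be a real Hilbert space, let B be the infinitesimal generator of a strongly continuous group G_B of bounded linear operators on V, and let L ∈ L(V) be a bounded linear operator. Let C : Dom C ⊆ V → V be a closed linear operator such that 0 belongs to the resolvent set of C, i.e. C has a bounded everywhere-defined inverse C^{-1} ∈ L(V). Let K ⊆ Dom B be a core for B (the closure of the restriction of B to K equals B), and assume that for every z ∈ K one has C^{-1}z ∈ Dom B, B C^{-1} z ∈ Dom C, and C B C^{-1} z = B z + L z. Then for every λ belonging to both the resolvent set of B and the resolvent set of B + L (with Dom(B+L) = Dom B), one has the identity of bounded operators C (λ − B)^{-1} C^{-1} = (λ − (B+L))^{-1} on V. -/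
open MeasureTheory Filter Set Topology

/-- `R` is the resolvent at `lam` of the (possibly unbounded) operator `K` with domain
`dom`: `λ − K : dom → V` is a bijection with bounded inverse `R`. -/
def IsResolvent {V : Type*} [NormedAddCommGroup V] [NormedSpace ℝ V]
    (dom : Set V) (K : V → V) (lam : ℝ) (R : V →L[ℝ] V) : Prop :=
  (∀ x ∈ dom, R (lam • x - K x) = x) ∧ ∀ y : V, R y ∈ dom ∧ lam • R y - K (R y) = y

/-- if `B` generates a strongly continuous group, `C` is a closed operator with
bounded everywhere-defined inverse, `K` is a core of `B` and `C B C⁻¹ z = B z + L z` on `K`,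
then `C (λ − B)⁻¹ C⁻¹ = (λ − (B + L))⁻¹` for every `λ` in both resolvent sets. -/
theorem statement5
    {V : Type*} [NormedAddCommGroup V] [InnerProductSpace ℝ V] [CompleteSpace V]
    -- the strongly continuous group `G` and its infinitesimal generator `B` on `domB`:
    (G : ℝ → V →L[ℝ] V)
    (hG0 : G 0 = ContinuousLinearMap.id ℝ V)
    (hGadd : ∀ s t : ℝ, G (s + t) = (G s).comp (G t))
    (hGcont : ∀ x : V, Continuous fun t : ℝ => G t x)
    (domB : Set V) (B : V → V)
    (hdomB : ∀ x : V, x ∈ domB ↔ ∃ y : V, HasDerivAt (fun τ : ℝ => G τ x) y 0)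
    (hBgen : ∀ x ∈ domB, HasDerivAt (fun τ : ℝ => G τ x) (B x) 0)
    -- the bounded operator `L`:
    (L : V →L[ℝ] V)
    -- the closed linear operator `C` on `domC`:
    (domC : Set V) (C : V → V)
    (hdomC_add : ∀ x ∈ domC, ∀ y ∈ domC, x + y ∈ domC)
    (hdomC_smul : ∀ (a : ℝ), ∀ x ∈ domC, a • x ∈ domC)
    (hC_add : ∀ x ∈ domC, ∀ y ∈ domC, C (x + y) = C x + C y)
    (hC_smul : ∀ (a : ℝ), ∀ x ∈ domC, C (a • x) = a • C x)
    (hC_closed : ∀ (x : ℕ → V) (u y : V), (∀ n, x n ∈ domC) →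
      Tendsto x atTop (𝓝 u) → Tendsto (fun n => C (x n)) atTop (𝓝 y) →
      u ∈ domC ∧ C u = y)
    -- `0` belongs to the resolvent set of `C`, with bounded inverse `Cinv`:
    (Cinv : V →L[ℝ] V)
    (hCinv_left : ∀ x ∈ domC, Cinv (C x) = x)
    (hCinv_right : ∀ y : V, Cinv y ∈ domC ∧ C (Cinv y) = y)
    -- `K` is a core for `B`:
    (K : Set V) (hK : K ⊆ domB)
    (hcore : ∀ x ∈ domB, ∃ u : ℕ → V, (∀ n, u n ∈ K) ∧
      Tendsto u atTop (𝓝 x) ∧ Tendsto (fun n => B (u n)) atTop (𝓝 (B x)))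
    -- the intertwining hypothesis on the core:
    (hint : ∀ z ∈ K, Cinv z ∈ domB ∧ B (Cinv z) ∈ domC ∧ C (B (Cinv z)) = B z + L z) :
    ∀ (lam : ℝ) (RB RBL : V →L[ℝ] V),
      IsResolvent domB B lam RB →
      IsResolvent domB (fun x => B x + L x) lam RBL →
      ∀ y : V, RB (Cinv y) ∈ domC ∧ C (RB (Cinv y)) = RBL y := by
  intro lam RB RBL hRB hRBL y
  obtain ⟨hx, hxy⟩ := hRBL.2 y
  obtain ⟨u, huK, hu, hBu⟩ := hcore _ hx
  have key : ∀ n, RB (Cinv (lam • u n - (B (u n) + L (u n)))) = Cinv (u n) := by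
    intro n
    obtain ⟨h1, h2, h3⟩ := hint _ (huK n)
    have h4 := hCinv_left _ h2
    rw [h3] at h4
    rw [map_sub, h4, map_smul]
    exact hRB.1 _ h1
  have t1 : Tendsto (fun n => RB (Cinv (lam • u n - (B (u n) + L (u n))))) atTop
      (𝓝 (RB (Cinv (lam • RBL y - (B (RBL y) + L (RBL y)))))) :=
    (RB.continuous.tendsto _).comp ((Cinv.continuous.tendsto _).comp
      ((hu.const_smul lam).sub (hBu.add ((L.continuous.tendsto _).comp hu))))
  have t2 : Tendsto (fun n => Cinv (u n)) atTop (𝓝 (Cinv (RBL y))) :=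
    (Cinv.continuous.tendsto _).comp hu
  simp only [key] at t1
  have e := tendsto_nhds_unique t1 t2
  have hxy' : lam • RBL y - (B (RBL y) + L (RBL y)) = y := hxy
  rw [hxy'] at e
  rw [e]
  exact hCinv_right _
end

section
/- Let V be a real Hilbert space, let B be the infinitesimal generator of a strongly continuous group G_B of bounded linear operators on V, let L ∈ L(V), and let G' be a strongly continuous group of bounded linear operators on V whose infinitesimal generator is B + L with domain Dom B. Let C : Dom C ⊆ V → V be a closed linear operator with bounded everywhere-defined inverse C^{-1} ∈ L(V). Assume there exists λ* > 0 such that every real λ with |λ| > λ* belongs to both the resolvent set of B and the resolvent set of B + L, and C (λ − B)^{-1} C^{-1} = (λ − (B+L))^{-1} for all such λ. Then for every x ∈ ℝ the group G_B leaves Dom C invariant, i.e. G_B(x)(Dom C) ⊆ Dom C, and C G_B(x) C^{-1} = G'(x) as bounded operators on V. -/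
open MeasureTheory Filter Set Topology

lemma aux_bound {V : Type*} [NormedAddCommGroup V] [NormedSpace ℝ V] [CompleteSpace V]
    (G : ℝ → V →L[ℝ] V) (hGcont : ∀ x : V, Continuous fun t : ℝ => G t x) :
    ∃ M : ℝ, ∀ t ∈ Icc (-1 : ℝ) 1, ‖G t‖ ≤ M := by
  have h : ∃ M, ∀ t : Icc (-1 : ℝ) 1, ‖G t‖ ≤ M := by
    apply banach_steinhaus
    intro x
    obtain ⟨c, hc⟩ := isCompact_Icc.exists_bound_of_continuousOn (s := Icc (-1 : ℝ) 1)
      (hGcont x).continuousOn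
    exact ⟨c, fun t => hc t t.2⟩
  obtain ⟨M, hM⟩ := h
  exact ⟨M, fun t ht => hM ⟨t, ht⟩⟩

lemma aux_deriv {V : Type*} [NormedAddCommGroup V] [NormedSpace ℝ V] [CompleteSpace V]
    (G : ℝ → V →L[ℝ] V) (hG0 : G 0 = ContinuousLinearMap.id ℝ V)
    (hGcont : ∀ x : V, Continuous fun t : ℝ => G t x)
    (w : ℝ → V) (w' b : V) (hw : HasDerivAt w w' 0)
    (hb : HasDerivAt (fun τ : ℝ => G τ (w 0)) b 0) :
    HasDerivAt (fun τ : ℝ => G (-τ) (w τ)) (w' - b) 0 := by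
  obtain ⟨M, hM⟩ := aux_bound G hGcont
  have h2 : HasDerivAt (fun τ : ℝ => G (-τ) (w 0)) (-b) 0 := by
    have hb' : HasDerivAt (fun τ : ℝ => G τ (w 0)) b (-0) := by simpa using hb
    have := hb'.scomp (0 : ℝ) (hasDerivAt_neg (0 : ℝ))
    simpa [Function.comp_def] using this
  have h1 : HasDerivAt (fun τ : ℝ => G (-τ) (w τ - w 0 - τ • w')) 0 0 := by
    rw [hasDerivAt_iff_isLittleO] at hw ⊢
    simp only [sub_zero, smul_zero, zero_smul, sub_self, map_zero] at hw ⊢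
    refine Asymptotics.IsBigO.trans_isLittleO ?_ hw
    refine Asymptotics.IsBigO.of_bound M ?_
    filter_upwards [Icc_mem_nhds (show (-1 : ℝ) < 0 by norm_num) (show (0 : ℝ) < 1 by norm_num)]
      with t ht
    have ht' : -t ∈ Icc (-1 : ℝ) 1 := ⟨by linarith [ht.2], by linarith [ht.1]⟩
    exact (G (-t)).le_of_opNorm_le (hM _ ht') _
  have h3 : HasDerivAt (fun τ : ℝ => τ • G (-τ) w') w' 0 := by
    rw [hasDerivAt_iff_isLittleO]
    simp only [sub_zero, zero_smul]
    have hc : Tendsto (fun τ : ℝ => G (-τ) w' - w') (𝓝 0) (𝓝 0) := by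
      have : Continuous (fun τ : ℝ => G (-τ) w' - w') :=
        ((hGcont w').comp continuous_neg).sub continuous_const
      have h := this.tendsto 0
      simpa [hG0] using h
    have := (Asymptotics.isBigO_refl (fun τ : ℝ => τ) (𝓝 0)).smul_isLittleO
      ((Asymptotics.isLittleO_one_iff ℝ).2 hc)
    simpa [smul_sub] using this
  have h := (h1.add h2).add h3
  have e : (0 + -b + w') = w' - b := by abel
  rw [e] at h
  refine h.congr_of_eventuallyEq (Eventually.of_forall fun τ => ?_)
  simp only [Pi.add_apply, map_sub, map_smul]
  abel

/-- Group invariance of the domain and commutation with the generator. -/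
lemma aux_inv {V : Type*} [NormedAddCommGroup V] [NormedSpace ℝ V]
    (G : ℝ → V →L[ℝ] V)
    (hGadd : ∀ s t : ℝ, G (s + t) = (G s).comp (G t))
    (domB : Set V) (B : V → V)
    (hdomB : ∀ x : V, x ∈ domB ↔ ∃ y : V, HasDerivAt (fun τ : ℝ => G τ x) y 0)
    (hBgen : ∀ x ∈ domB, HasDerivAt (fun τ : ℝ => G τ x) (B x) 0)
    (t : ℝ) (x : V) (hx : x ∈ domB) : G t x ∈ domB ∧ B (G t x) = G t (B x) := by
  have h : HasDerivAt (fun τ : ℝ => G τ (G t x)) (G t (B x)) 0 := by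
    have := (G t).hasFDerivAt.comp_hasDerivAt (0 : ℝ) (hBgen x hx)
    refine this.congr_of_eventuallyEq (Eventually.of_forall fun τ => ?_)
    simp only [Function.comp]
    rw [← ContinuousLinearMap.comp_apply, ← ContinuousLinearMap.comp_apply, ← hGadd, ← hGadd,
      add_comm]
  have hm : G t x ∈ domB := (hdomB _).2 ⟨_, h⟩
  exact ⟨hm, (hBgen _ hm).unique h⟩

lemma aux_res {V : Type*} [NormedAddCommGroup V] [NormedSpace ℝ V]
    (G : ℝ → V →L[ℝ] V)
    (hGadd : ∀ s t : ℝ, G (s + t) = (G s).comp (G t))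
    (domB : Set V) (B : V → V)
    (hdomB : ∀ x : V, x ∈ domB ↔ ∃ y : V, HasDerivAt (fun τ : ℝ => G τ x) y 0)
    (hBgen : ∀ x ∈ domB, HasDerivAt (fun τ : ℝ => G τ x) (B x) 0)
    (lam : ℝ) (R : V →L[ℝ] V) (hR : IsResolvent domB B lam R)
    (t : ℝ) (y : V) : R (G t y) = G t (R y) := by
  obtain ⟨hm, he⟩ := hR.2 y
  obtain ⟨hm', he'⟩ := aux_inv G hGadd domB B hdomB hBgen t _ hm
  have := hR.1 _ hm'
  rw [he', ← map_smul, ← map_sub, he] at this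
  exact this

/-- if `B` generates the group `G_B`, `B + L` (domain `Dom B`) generates the
group `G'`, `C` is closed with bounded everywhere-defined inverse, and
`C (λ − B)⁻¹ C⁻¹ = (λ − (B+L))⁻¹` for all real `λ` with `|λ| > λ*`, then `G_B` leaves
`Dom C` invariant and `C G_B(x) C⁻¹ = G'(x)` for every `x ∈ ℝ`. -/
theorem statement6
    {V : Type*} [NormedAddCommGroup V] [InnerProductSpace ℝ V] [CompleteSpace V]
    -- the strongly continuous group `G` and its infinitesimal generator `B` on `domB`:
    (G : ℝ → V →L[ℝ] V)
    (hG0 : G 0 = ContinuousLinearMap.id ℝ V)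
    (hGadd : ∀ s t : ℝ, G (s + t) = (G s).comp (G t))
    (hGcont : ∀ x : V, Continuous fun t : ℝ => G t x)
    (domB : Set V) (B : V → V)
    (hdomB : ∀ x : V, x ∈ domB ↔ ∃ y : V, HasDerivAt (fun τ : ℝ => G τ x) y 0)
    (hBgen : ∀ x ∈ domB, HasDerivAt (fun τ : ℝ => G τ x) (B x) 0)
    -- the bounded operator `L`, and the group `G'` generated by `B + L` on `domB`:
    (L : V →L[ℝ] V)
    (G' : ℝ → V →L[ℝ] V)
    (hG'0 : G' 0 = ContinuousLinearMap.id ℝ V)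
    (hG'add : ∀ s t : ℝ, G' (s + t) = (G' s).comp (G' t))
    (hG'cont : ∀ x : V, Continuous fun t : ℝ => G' t x)
    (hdomB' : ∀ x : V, x ∈ domB ↔ ∃ y : V, HasDerivAt (fun τ : ℝ => G' τ x) y 0)
    (hG'gen : ∀ x ∈ domB, HasDerivAt (fun τ : ℝ => G' τ x) (B x + L x) 0)
    -- the closed linear operator `C` on `domC` with bounded inverse `Cinv`:
    (domC : Set V) (C : V → V)
    (hdomC_add : ∀ x ∈ domC, ∀ y ∈ domC, x + y ∈ domC)
    (hdomC_smul : ∀ (a : ℝ), ∀ x ∈ domC, a • x ∈ domC)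
    (hC_add : ∀ x ∈ domC, ∀ y ∈ domC, C (x + y) = C x + C y)
    (hC_smul : ∀ (a : ℝ), ∀ x ∈ domC, C (a • x) = a • C x)
    (hC_closed : ∀ (x : ℕ → V) (u y : V), (∀ n, x n ∈ domC) →
      Tendsto x atTop (𝓝 u) → Tendsto (fun n => C (x n)) atTop (𝓝 y) →
      u ∈ domC ∧ C u = y)
    (Cinv : V →L[ℝ] V)
    (hCinv_left : ∀ x ∈ domC, Cinv (C x) = x)
    (hCinv_right : ∀ y : V, Cinv y ∈ domC ∧ C (Cinv y) = y)
    -- the resolvent intertwining hypothesis for large `|λ|`: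
    (lamStar : ℝ) (hlamStar : 0 < lamStar)
    (hres : ∀ lam : ℝ, lamStar < |lam| →
      ∃ RB RBL : V →L[ℝ] V,
        IsResolvent domB B lam RB ∧
        IsResolvent domB (fun x => B x + L x) lam RBL ∧
        ∀ y : V, RB (Cinv y) ∈ domC ∧ C (RB (Cinv y)) = RBL y) :
    ∀ x : ℝ, (∀ v ∈ domC, G x v ∈ domC) ∧
      ∀ v : V, C (G x (Cinv v)) = G' x v := by
  obtain ⟨RB, RBL, hRB, hRBL, hC⟩ := hres (lamStar + 1) (by
    rw [abs_of_pos (by linarith)]; linarith)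
  have hint : ∀ y, RB (Cinv y) = Cinv (RBL y) := fun y => by
    rw [← (hC y).2, hCinv_left _ (hC y).1]
  have hgen : ∀ x ∈ domB, Cinv x ∈ domB ∧ B (Cinv x) = Cinv (B x + L x) := by
    intro x hx
    have h1 := hRBL.1 x hx
    have h2 := hint ((lamStar + 1) • x - (B x + L x))
    simp only at h1
    rw [h1] at h2
    obtain ⟨h3, h4⟩ := hRB.2 (Cinv ((lamStar + 1) • x - (B x + L x)))
    rw [h2] at h3 h4
    refine ⟨h3, ?_⟩
    rw [map_sub, map_smul] at h4
    exact sub_right_injective h4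
  have hinv' := aux_inv G' hG'add domB (fun x => B x + L x) hdomB' hG'gen
  have hcancel : ∀ t v, G t (G (-t) v) = v := fun t v => by
    rw [← ContinuousLinearMap.comp_apply, ← hGadd]; simp [hG0]
  have hdom : ∀ x ∈ domB, ∀ t, G t (Cinv x) = Cinv (G' t x) := by
    intro x hx t
    have hd : ∀ s, HasDerivAt (fun τ : ℝ => G (-τ) (Cinv (G' τ x))) 0 s := by
      intro s
      have hz := (hinv' s x hx).1
      obtain ⟨h3, h4⟩ := hgen _ hz
      have hw : HasDerivAt (fun τ : ℝ => Cinv (G' τ (G' s x)))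
          (Cinv (B (G' s x) + L (G' s x))) 0 :=
        Cinv.hasFDerivAt.comp_hasDerivAt (0 : ℝ) (hG'gen _ hz)
      have hb : HasDerivAt (fun τ : ℝ => G τ (Cinv (G' 0 (G' s x))))
          (B (Cinv (G' s x))) 0 := by
        simpa [hG'0] using hBgen _ h3
      have hk := aux_deriv G hG0 hGcont _ _ _ hw hb
      rw [h4, sub_self] at hk
      have hk2 := (G (-s)).hasFDerivAt.comp_hasDerivAt (0 : ℝ) hk
      rw [map_zero] at hk2
      have hk3 : HasDerivAt (fun τ : ℝ => G (-s) (G (-(τ - s)) (Cinv (G' (τ - s) (G' s x))))) 0 s := by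
        have hk2' := hk2
        rw [← sub_self s] at hk2'
        exact hk2'.comp_sub_const s s
      refine hk3.congr_of_eventuallyEq (Eventually.of_forall fun τ => ?_)
      simp only
      rw [← ContinuousLinearMap.comp_apply (G' _), ← hG'add,
        ← ContinuousLinearMap.comp_apply (G (-s)), ← hGadd, sub_add_cancel,
        show -s + -(τ - s) = -τ by ring]
    have hconst := is_const_of_deriv_eq_zero (fun s => (hd s).differentiableAt)
      (fun s => (hd s).deriv) t 0
    simp only [neg_zero, hG0, hG'0, ContinuousLinearMap.id_apply] at hconst
    rw [← hconst, hcancel]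
  have hmain : ∀ t v, G t (Cinv v) = Cinv (G' t v) := by
    intro t v
    have e : RB (G t (Cinv v)) = RB (Cinv (G' t v)) := by
      rw [aux_res G hGadd domB B hdomB hBgen _ RB hRB, hint, hint,
        aux_res G' hG'add domB (fun x => B x + L x) hdomB' hG'gen _ RBL hRBL]
      exact hdom _ (hRBL.2 v).1 t
    have e1 := (hRB.2 (G t (Cinv v))).2
    rw [e, (hRB.2 _).2] at e1
    exact e1.symm
  intro t
  refine ⟨fun v hv => ?_, fun v => ?_⟩
  · rw [← hCinv_left v hv, hmain]
    exact (hCinv_right _).1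
  · rw [hmain]
    exact (hCinv_right _).2
end

section
/- Let g : ℝ → ℝ be continuous and suppose there are constants 0 < c₁ ≤ c₂ < ∞ with c₁ ≤ g(x) ≤ c₂ for all x ∈ ℝ. Fix c ∈ ℝ and define h(x) := ∫_c^x dr/g(r); h is a continuously differentiable increasing bijection of ℝ onto ℝ with continuous inverse h^{-1}. For each t ∈ ℝ, the formula (G_{g∂}(t)f)(x) := f(h^{-1}(h(x)+t)) defines a bounded linear operator G_{g∂}(t) on L²(ℝ), and the family (G_{g∂}(t))_{t∈ℝ} is a strongly continuous group: G_{g∂}(0) = Id, G_{g∂}(s+t) = G_{g∂}(s) G_{g∂}(t) for all s,t ∈ ℝ, and for every f ∈ L²(ℝ) the map t ↦ G_{g∂}(t)f is continuous from ℝ to L²(ℝ). -/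
open MeasureTheory Filter Set Topology Function

theorem aux_map_le (u v : ℝ → ℝ) (K : NNReal) (hu : Continuous u) (hv : LipschitzWith K v)
    (h1 : LeftInverse u v) (h2 : RightInverse u v) :
    Measure.map u (volume : Measure ℝ) ≤ (K : ENNReal) • (volume : Measure ℝ) := by
  refine Measure.le_iff.2 fun s hs => ?_
  rw [Measure.map_apply hu.measurable hs, ← Set.image_eq_preimage_of_inverse h1 h2]
  have := hv.hausdorffMeasure_image_le zero_le_one s
  rw [hausdorffMeasure_real] at this
  simpa using this

theorem aux_qmp (u v : ℝ → ℝ) (K : NNReal) (hu : Continuous u) (hv : LipschitzWith K v)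
    (h1 : LeftInverse u v) (h2 : RightInverse u v) :
    Measure.QuasiMeasurePreserving u (volume : Measure ℝ) (volume : Measure ℝ) :=
  ⟨hu.measurable, Measure.absolutelyContinuous_of_le_smul (aux_map_le u v K hu hv h1 h2)⟩

theorem aux_comp (u v : ℝ → ℝ) (K : NNReal) (hu : Continuous u) (hv : LipschitzWith K v)
    (h1 : LeftInverse u v) (h2 : RightInverse u v) :
    ∃ U : Lp ℝ 2 (volume : Measure ℝ) →L[ℝ] Lp ℝ 2 (volume : Measure ℝ),
      ∀ f, (U f : ℝ → ℝ) =ᵐ[(volume : Measure ℝ)] fun x => f (u x) := by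
  have hq := aux_qmp u v K hu hv h1 h2
  have hle := aux_map_le u v K hu hv h1 h2
  have hm : ∀ f : Lp ℝ 2 (volume : Measure ℝ), MemLp (f ∘ u) 2 (volume : Measure ℝ) := fun f =>
    ((Lp.memLp f).of_measure_le_smul ENNReal.coe_ne_top hle).comp_of_map hu.aemeasurable
  let L : Lp ℝ 2 (volume : Measure ℝ) →ₗ[ℝ] Lp ℝ 2 (volume : Measure ℝ) :=
    { toFun := fun f => (hm f).toLp _
      map_add' := by
        intro f g
        apply Lp.ext
        filter_upwards [(hm (f + g)).coeFn_toLp, (hm f).coeFn_toLp, (hm g).coeFn_toLp,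
          Lp.coeFn_add ((hm f).toLp _) ((hm g).toLp _), hq.ae (Lp.coeFn_add f g)]
          with x a1 a2 a3 a4 a5
        rw [a1, a4]
        simp only [Pi.add_apply, Function.comp_apply] at *
        rw [a2, a3, a5]
      map_smul' := by
        intro r f
        apply Lp.ext
        filter_upwards [(hm (r • f)).coeFn_toLp, (hm f).coeFn_toLp,
          Lp.coeFn_smul r ((hm f).toLp _), hq.ae (Lp.coeFn_smul r f)]
          with x a1 a2 a4 a5
        simp only [RingHom.id_apply]
        rw [a1, a4]
        simp only [Pi.smul_apply, Function.comp_apply] at *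
        rw [a2, a5] }
  refine ⟨L.mkContinuous ((K : ENNReal) ^ (1 / (2 : ENNReal)).toReal).toReal ?_, ?_⟩
  · intro f
    change ‖(hm f).toLp _‖ ≤ _
    rw [Lp.norm_toLp, Lp.norm_def, ← ENNReal.toReal_mul]
    apply ENNReal.toReal_mono
    · exact ENNReal.mul_ne_top (by simp) (Lp.eLpNorm_ne_top f)
    · rw [← eLpNorm_map_measure ((Lp.aestronglyMeasurable f).mono_ac hq.absolutelyContinuous)
        hu.aemeasurable]
      exact (eLpNorm_mono_measure _ hle).trans (eLpNorm_smul_measure_le _ _ _ _)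
  · intro f
    exact (hm f).coeFn_toLp

/-- for continuous `g` with `0 < c₁ ≤ g ≤ c₂` and `h(x) = ∫_c^x dr/g(r)`,
`h` is a continuously differentiable increasing bijection of `ℝ` onto `ℝ` with continuous
inverse, and `(G_{g∂}(t)f)(x) := f(h⁻¹(h(x)+t))` defines a strongly continuous group of
bounded linear operators on `L²(ℝ)`. -/
theorem statement8
    (g : ℝ → ℝ) (hg : Continuous g)
    (c₁ c₂ : ℝ) (hc₁ : 0 < c₁) (hbound : ∀ x : ℝ, c₁ ≤ g x ∧ g x ≤ c₂)
    (c : ℝ) (h : ℝ → ℝ) (hh : ∀ x : ℝ, h x = ∫ r in c..x, (g r)⁻¹) :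
    (StrictMono h ∧ Function.Bijective h ∧ (∀ x : ℝ, HasDerivAt h (g x)⁻¹ x) ∧
      Continuous (invFun h)) ∧
    ∃ G : ℝ → Lp ℝ 2 (volume : Measure ℝ) →L[ℝ] Lp ℝ 2 (volume : Measure ℝ),
      (∀ (t : ℝ) (f : Lp ℝ 2 (volume : Measure ℝ)),
        (G t f : ℝ → ℝ) =ᵐ[(volume : Measure ℝ)] fun x => f (invFun h (h x + t))) ∧
      G 0 = ContinuousLinearMap.id ℝ (Lp ℝ 2 (volume : Measure ℝ)) ∧
      (∀ s t : ℝ, G (s + t) = (G s).comp (G t)) ∧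
      ∀ f : Lp ℝ 2 (volume : Measure ℝ), Continuous fun t : ℝ => G t f := by

  have hgpos : ∀ x, 0 < g x := fun x => hc₁.trans_le (hbound x).1
  have hc₂ : 0 < c₂ := (hgpos 0).trans_le (hbound 0).2
  have hcont : Continuous fun r => (g r)⁻¹ := hg.inv₀ fun x => (hgpos x).ne'
  have hder : ∀ x : ℝ, HasDerivAt h (g x)⁻¹ x := by
    intro x
    have : h = fun u => ∫ r in c..u, (g r)⁻¹ := funext hh
    rw [this]
    exact (hcont.integral_hasStrictDerivAt c x).hasDerivAt
  have hdiff : Differentiable ℝ h := fun x => (hder x).differentiableAt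
  have hmono : StrictMono h := strictMono_of_deriv_pos fun x => by
    rw [(hder x).deriv]; exact inv_pos.2 (hgpos x)
  have hlow : ∀ x y, x ≤ y → c₂⁻¹ * (y - x) ≤ h y - h x := by
    intro x y hxy
    refine mul_sub_le_image_sub_of_le_deriv hdiff (fun z => ?_) hxy
    rw [(hder z).deriv]
    exact inv_anti₀ (hgpos z) (hbound z).2
  have hup : ∀ x y, x ≤ y → h y - h x ≤ c₁⁻¹ * (y - x) := by
    intro x y hxy
    refine image_sub_le_mul_sub_of_deriv_le hdiff (fun z => ?_) hxy
    rw [(hder z).deriv]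
    exact inv_anti₀ hc₁ (hbound z).1
  have htop : Tendsto h atTop atTop := by
    have : Tendsto (fun y : ℝ => h 0 + c₂⁻¹ * y) atTop atTop :=
      tendsto_atTop_add_const_left _ _ (tendsto_id.const_mul_atTop (inv_pos.2 hc₂))
    refine tendsto_atTop_mono' _ ?_ this
    filter_upwards [eventually_ge_atTop 0] with y hy
    have := hlow 0 y hy
    rw [sub_zero] at this
    linarith
  have hbot : Tendsto h atBot atBot := by
    have : Tendsto (fun y : ℝ => h 0 + c₂⁻¹ * y) atBot atBot :=
      tendsto_atBot_add_const_left _ _ (tendsto_id.const_mul_atBot (inv_pos.2 hc₂))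
    refine tendsto_atBot_mono' _ ?_ this
    filter_upwards [eventually_le_atBot 0] with y hy
    have := hlow y 0 hy
    rw [zero_sub, mul_neg] at this
    linarith
  have hsurj : Surjective h := hdiff.continuous.surjective htop hbot
  have hL : LeftInverse (invFun h) h := leftInverse_invFun hmono.injective
  have hR : Function.RightInverse (invFun h) h := rightInverse_invFun hsurj
  have hlipk : LipschitzWith c₂.toNNReal (invFun h) := by
    refine LipschitzWith.of_dist_le_mul fun a b => ?_
    obtain ⟨x, rfl⟩ := hsurj a
    obtain ⟨y, rfl⟩ := hsurj b
    rw [hL, hL, Real.coe_toNNReal _ hc₂.le]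
    have key : ∀ x y, x ≤ y → dist x y ≤ c₂ * dist (h x) (h y) := by
      intro x y hxy
      rw [dist_comm, dist_comm (h x), Real.dist_eq, Real.dist_eq, abs_of_nonneg (by linarith),
        abs_of_nonneg (by linarith [hmono.monotone hxy])]
      have := hlow x y hxy
      rwa [inv_mul_le_iff₀ hc₂] at this
    rcases le_total x y with hxy | hxy
    · exact key x y hxy
    · rw [dist_comm, dist_comm (h x)]; exact key y x hxy
  have hliph : LipschitzWith c₁⁻¹.toNNReal h := by
    refine LipschitzWith.of_dist_le_mul fun x y => ?_
    rw [Real.coe_toNNReal _ (inv_pos.2 hc₁).le]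
    have key : ∀ x y, x ≤ y → dist (h x) (h y) ≤ c₁⁻¹ * dist x y := by
      intro x y hxy
      rw [dist_comm, dist_comm x, Real.dist_eq, Real.dist_eq,
        abs_of_nonneg (by linarith [hmono.monotone hxy]), abs_of_nonneg (by linarith)]
      exact hup x y hxy
    rcases le_total x y with hxy | hxy
    · exact key x y hxy
    · rw [dist_comm, dist_comm x]; exact key y x hxy
  refine ⟨⟨hmono, ⟨hmono.injective, hsurj⟩, hder, hlipk.continuous⟩, ?_⟩
  obtain ⟨U, hU⟩ := aux_comp (invFun h) h _ hlipk.continuous hliph hL hR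
  obtain ⟨V, hV⟩ := aux_comp h (invFun h) _ hliph.continuous hlipk hR hL
  have qk := aux_qmp (invFun h) h _ hlipk.continuous hliph hL hR
  have qh := aux_qmp h (invFun h) _ hliph.continuous hlipk hR hL
  let τ : ℝ → C(ℝ, ℝ) := fun t => ⟨fun x => x + t, by fun_prop⟩
  have hτ : ∀ t, MeasurePreserving (τ t) (volume : Measure ℝ) volume := fun t =>
    measurePreserving_add_right volume t
  have hτc : Continuous τ :=
    ContinuousMap.continuous_of_continuous_uncurry _ (by
      change Continuous fun p : ℝ × ℝ => p.2 + p.1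
      fun_prop)
  let T : ℝ → Lp ℝ 2 (volume : Measure ℝ) →L[ℝ] Lp ℝ 2 (volume : Measure ℝ) := fun t =>
    (Lp.compMeasurePreservingₗᵢ ℝ (τ t) (hτ t)).toContinuousLinearMap
  have hT : ∀ t f, (T t f : ℝ → ℝ) =ᵐ[(volume : Measure ℝ)] fun x => f (x + t) := fun t f =>
    Lp.coeFn_compMeasurePreserving f (hτ t)
  have hG : ∀ (t : ℝ) (f : Lp ℝ 2 (volume : Measure ℝ)),
      (V (T t (U f)) : ℝ → ℝ) =ᵐ[(volume : Measure ℝ)] fun x => f (invFun h (h x + t)) := by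
    intro t f
    filter_upwards [hV (T t (U f)), qh.ae (hT t (U f)),
      qh.ae ((hτ t).quasiMeasurePreserving.ae (hU f))] with x a1 a2 a3
    rw [a1, a2]
    exact a3
  refine ⟨fun t => V.comp ((T t).comp U), hG, ?_, ?_, ?_⟩
  · ext1 f
    apply Lp.ext
    refine (hG 0 f).trans (Eventually.of_forall fun x => ?_)
    simp [hL x]
  · intro s t
    ext1 f
    apply Lp.ext
    have q : Measure.QuasiMeasurePreserving (fun x => invFun h (h x + s))
        (volume : Measure ℝ) volume := qk.comp ((hτ s).quasiMeasurePreserving.comp qh)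
    refine (hG (s + t) f).trans ?_
    filter_upwards [hG s (V (T t (U f))), q.ae (hG t f)] with x a1 a2
    refine Eq.trans ?_ (a1.trans a2).symm
    show (f : ℝ → ℝ) (invFun h (h x + (s + t))) = f (invFun h (h (invFun h (h x + s)) + t))
    rw [hR, add_assoc]
  · intro f
    refine V.continuous.comp ?_
    exact continuous_const.compMeasurePreservingLp hτc hτ (by simp)
end
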